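/- For all integers r, s, γ1, γ2 and every integer N ≥ 1: R(Nr, Ns, Nγ1, Nγ2) > 0 if and only if R(r, s, γ1, γ2) > 0. (The reduced Kronecker coefficients indexed by two one-row shapes satisfy the saturation property.) -/

import Mathlib

/-- `R r s γ1 γ2` counts the integral points `(X, Y)` satisfying the seven
inequalities `X ≥ s`, `X ≥ r`, `X + Y ≥ r + s − γ1`, `Y ≥ 0`,
`Y − X + γ1 + γ2 ≥ 0`, `X + Y ≤ r + s − γ2`, `X − Y ≥ γ1`. -/
noncomputable def R (r s γ1 γ2 : ℤ) : ℕ :=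
  Set.ncard {p : ℤ × ℤ |
    s ≤ p.1 ∧ r ≤ p.1 ∧ r + s - γ1 ≤ p.1 + p.2 ∧ 0 ≤ p.2 ∧
    0 ≤ p.2 - p.1 + γ1 + γ2 ∧ p.1 + p.2 ≤ r + s - γ2 ∧ γ1 ≤ p.1 - p.2}

/-- The polygon counted by `R` has only finitely many integral points. -/
theorem finite_R_points (r s γ1 γ2 : ℤ) : {p : ℤ × ℤ |
    s ≤ p.1 ∧ r ≤ p.1 ∧ r + s - γ1 ≤ p.1 + p.2 ∧ 0 ≤ p.2 ∧
    0 ≤ p.2 - p.1 + γ1 + γ2 ∧ p.1 + p.2 ≤ r + s - γ2 ∧ γ1 ≤ p.1 - p.2}.Finite := by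
  refine (Set.finite_Icc ((r, 0) : ℤ × ℤ) (r + s - γ2, s - γ2)).subset ?_
  rintro ⟨X, Y⟩ h
  simp only [Set.mem_ofPred_eq] at h
  simp only [Set.mem_Icc, Prod.mk_le_mk]
  omega

/-- Positivity of `R` is governed by homogeneous linear inequalities. -/
theorem R_pos_iff (r s γ1 γ2 : ℤ) :
    0 < R r s γ1 γ2 ↔ 0 ≤ γ2 ∧ γ2 ≤ γ1 ∧ γ2 ≤ r ∧ γ2 ≤ s ∧
      r ≤ s + γ1 ∧ s ≤ r + γ1 ∧ γ1 + γ2 ≤ r + s := by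
  rw [R, Set.ncard_pos (finite_R_points r s γ1 γ2)]
  constructor
  · rintro ⟨⟨X, Y⟩, h⟩
    simp only [Set.mem_ofPred_eq] at h
    omega
  · intro h
    rcases h.1.eq_or_lt with h0 | h0
    · refine ⟨((r + s - γ1) / 2 + γ1, (r + s - γ1) / 2), ?_⟩
      simp only [Set.mem_ofPred_eq]
      omega
    · refine ⟨(r + s - γ2 - max 0 ((r + s - γ1 - 2 * γ2 + 1) / 2),
        max 0 ((r + s - γ1 - 2 * γ2 + 1) / 2)), ?_⟩
      simp only [Set.mem_ofPred_eq]
      omega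

theorem stmt_8 (r s γ1 γ2 : ℤ) (N : ℤ) (hN : 1 ≤ N) :
    0 < R (N * r) (N * s) (N * γ1) (N * γ2) ↔ 0 < R r s γ1 γ2 := by
  have hN0 : 0 < N := by lia
  simp only [R_pos_iff, ← mul_add, mul_le_mul_iff_right₀ hN0, mul_nonneg_iff_of_pos_left hN0]
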